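/- arXiv:0905.0136 — 2 statements merged into one kernel-verified Lean document; each statement's English description precedes it below -/
import Mathlib

section
/- Let Γ be an amenable group, i.e. there exists a left-invariant mean on the bounded real-valued functions on Γ: a positive linear functional m on the space of bounded functions Γ → ℝ with m(1) = 1 and m(f∘L_γ) = m(f) for every γ ∈ Γ and every bounded f, where L_γ is left translation. Then for every homomorphism ρ : Γ → Homeo⁺(S¹), the map γ ↦ rot(ρ(γ)) is a group homomorphism Γ → ℝ/ℤ. -/
open Filter MeasureTheory Set
open scoped Classical

noncomputable section

/-- The circle `S¹ = ℝ/ℤ`. -/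
abbrev S1 : Type := AddCircle (1 : ℝ)

/-- `F : ℝ → ℝ` is an increasing homeomorphism of `ℝ` commuting with integer
translations which is a lift of `f : S¹ → S¹`. -/
def IsCircleLift (f : S1 → S1) (F : ℝ → ℝ) : Prop :=
  StrictMono F ∧ Function.Surjective F ∧ (∀ x, F (x + 1) = F x + 1) ∧
    ∀ x : ℝ, f (x : S1) = (F x : S1)

/-- `f` is an orientation preserving homeomorphism of the circle. -/
def IsOPH (f : S1 → S1) : Prop := ∃ F, IsCircleLift f F

/-- The unique lift `f̄` of `f ∈ Homeo⁺(S¹)` with `f̄ 0 ∈ [0,1)`. -/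
def posLift (f : S1 → S1) : ℝ → ℝ :=
  if h : ∃ F, IsCircleLift f F ∧ F 0 ∈ Set.Ico (0 : ℝ) 1 then h.choose else id

/-- The Euler cocycle `c(f,g)`, defined by `f̄(ḡ(x)) = (f∘g)‾(x) + c(f,g)` where
`f̄` denotes the lift of `f` with `f̄ 0 ∈ [0,1)`. -/
def euler (f g : S1 → S1) : ℝ :=
  posLift f (posLift g 0) - posLift (fun x => f (g x)) 0

/-- A quasi-conjugacy: a self-map of the circle induced by a monotone increasing
map of `ℝ` commuting with integer translations. -/
def IsQuasiConjMap (h : S1 → S1) : Prop :=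
  ∃ H : ℝ → ℝ, Monotone H ∧ (∀ x, H (x + 1) = H x + 1) ∧ ∀ x : ℝ, h (x : S1) = (H x : S1)

/-- `ρ₀` and `ρ₁` are quasi-conjugate: there is a quasi-conjugacy `h` with
`h ∘ ρ₀ γ = ρ₁ γ ∘ h` for all `γ`. -/
def QuasiConj {Γ : Type*} (ρ₀ ρ₁ : Γ → S1 → S1) : Prop :=
  ∃ h, IsQuasiConjMap h ∧ ∀ γ, h ∘ ρ₀ γ = ρ₁ γ ∘ h

/-- `ρ` is an action of `Γ` on the circle by orientation preserving homeomorphisms,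
i.e. a homomorphism `Γ → Homeo⁺(S¹)`. -/
def IsCircleAction (Γ : Type*) [Group Γ] (ρ : Γ → S1 → S1) : Prop :=
  (∀ γ, IsOPH (ρ γ)) ∧ ρ 1 = id ∧ ∀ γ η, ρ (γ * η) = ρ γ ∘ ρ η

/-- The Poincaré rotation number `rot(f) = lim_{n→∞} f̄ⁿ(0)/n  mod ℤ`. -/
def rotN (f : S1 → S1) : S1 :=
  ((limUnder Filter.atTop fun n : ℕ => (posLift f)^[n] 0 / (n : ℝ) : ℝ) : S1)

/-- A function `Γ → ℝ` is bounded. -/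
def IsBdd {Γ : Type*} (f : Γ → ℝ) : Prop := ∃ C : ℝ, ∀ γ, |f γ| ≤ C

/-- `Γ` is amenable: there is a left-invariant mean on the bounded real-valued
functions on `Γ`, i.e. a positive linear functional `m` with `m 1 = 1` which is
invariant under left translations. -/
def HasInvariantMean (Γ : Type*) [Group Γ] : Prop :=
  ∃ m : (Γ → ℝ) → ℝ,
    (∀ f g : Γ → ℝ, IsBdd f → IsBdd g → m (f + g) = m f + m g) ∧
    (∀ (c : ℝ) (f : Γ → ℝ), IsBdd f → m (c • f) = c * m f) ∧
    (∀ f : Γ → ℝ, IsBdd f → (∀ γ, 0 ≤ f γ) → 0 ≤ m f) ∧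
    m (fun _ => (1 : ℝ)) = 1 ∧
    (∀ (γ : Γ) (f : Γ → ℝ), IsBdd f → m (fun x => f (γ * x)) = m f)

lemma IsBdd.of_abs_sub_le {Γ : Type*} {f : Γ → ℝ} {a c : ℝ} (h : ∀ γ, |f γ - a| ≤ c) :
    IsBdd f :=
  ⟨|a| + c, fun γ => by
    have := abs_add_le a (f γ - a)
    rw [add_sub_cancel] at this
    linarith [h γ]⟩

/-- The mean of a function lying within `c` of `a` lies within `c` of `a`. -/
lemma abs_mean_sub_le {Γ : Type*} {m : (Γ → ℝ) → ℝ}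
    (hadd : ∀ f g : Γ → ℝ, IsBdd f → IsBdd g → m (f + g) = m f + m g)
    (hsmul : ∀ (c : ℝ) (f : Γ → ℝ), IsBdd f → m (c • f) = c * m f)
    (hpos : ∀ f : Γ → ℝ, IsBdd f → (∀ γ, 0 ≤ f γ) → 0 ≤ m f)
    (hone : m (fun _ => (1 : ℝ)) = 1)
    {f : Γ → ℝ} {a c : ℝ} (h : ∀ γ, |f γ - a| ≤ c) : |m f - a| ≤ c := by
  have hf : IsBdd f := .of_abs_sub_le h
  have hb1 : IsBdd (fun _ : Γ => (1 : ℝ)) := ⟨1, fun _ => by simp⟩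
  have key (s t : ℝ) (hst : ∀ γ, 0 ≤ s * f γ + t) : 0 ≤ s * m f + t := by
    obtain ⟨C, hC⟩ := hf
    have hs : IsBdd (s • f) := ⟨|s| * C, fun γ => by
      simpa [abs_mul] using mul_le_mul_of_nonneg_left (hC γ) (abs_nonneg s)⟩
    have ht : IsBdd (t • fun _ : Γ => (1 : ℝ)) := ⟨|t|, fun γ => by simp⟩
    have hst' : IsBdd (s • f + t • fun _ : Γ => (1 : ℝ)) := by
      obtain ⟨A, hA⟩ := hs
      obtain ⟨B, hB⟩ := ht
      exact ⟨A + B, fun γ => (abs_add_le _ _).trans (add_le_add (hA γ) (hB γ))⟩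
    have := hpos _ hst' fun γ => by simpa using hst γ
    rwa [hadd _ _ hs ht, hsmul _ _ ⟨C, hC⟩, hsmul _ _ hb1, hone, mul_one] at this
  have h1 := key 1 (c - a) fun γ => by linarith [(abs_le.1 (h γ)).1]
  have h2 := key (-1) (c + a) fun γ => by linarith [(abs_le.1 (h γ)).2]
  exact abs_le.2 ⟨by linarith, by linarith⟩

lemma S1.coe_eq_coe_iff {x y : ℝ} : (x : S1) = (y : S1) ↔ ∃ n : ℤ, x = y + n := by
  rw [← sub_eq_zero, ← AddCircle.coe_sub, AddCircle.coe_eq_zero_iff]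
  refine exists_congr fun n => ?_
  rw [zsmul_one, eq_sub_iff_add_eq', eq_comm]

lemma CircleDeg1Lift.abs_map_sub_sub_map_zero_le (F : CircleDeg1Lift) (x : ℝ) :
    |F x - x - F 0| ≤ 1 := by
  have h0 := F.monotone (Int.fract_nonneg x)
  have h1 := F.monotone (Int.fract_lt_one x).le
  have h2 := F.map_add_one 0
  rw [zero_add] at h2
  have h3 := F.map_fract_sub_fract_eq x
  have h4 := Int.fract_nonneg x
  have h5 := Int.fract_lt_one x
  exact abs_le.2 ⟨by linarith, by linarith⟩

lemma CircleDeg1Lift.map_sub_eq_of_coe_eq (F : CircleDeg1Lift) {x y : ℝ}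
    (h : (x : S1) = (y : S1)) : F x - x = F y - y := by
  obtain ⟨n, rfl⟩ := S1.coe_eq_coe_iff.1 h
  rw [F.map_add_int]
  ring

lemma IsCircleLift.comp {f g : S1 → S1} {F G : ℝ → ℝ} (hF : IsCircleLift f F)
    (hG : IsCircleLift g G) : IsCircleLift (f ∘ g) (F ∘ G) :=
  ⟨hF.1.comp hG.1, hF.2.1.comp hG.2.1, fun x => by simp [hF.2.2.1, hG.2.2.1],
    fun x => by simp [hF.2.2.2, hG.2.2.2]⟩

/-- Two lifts of the same circle map differ by an integer translation. -/
lemma IsCircleLift.exists_eq_add_int {f : S1 → S1} {F G : CircleDeg1Lift}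
    (hF : IsCircleLift f F) (hG : IsCircleLift f G) : ∃ k : ℤ, ∀ x, F x = G x + k := by
  have hFG (x : ℝ) : ∃ n : ℤ, F x = G x + n :=
    S1.coe_eq_coe_iff.1 ((hF.2.2.2 x).symm.trans (hG.2.2.2 x))
  obtain ⟨k, hk⟩ := hFG 0
  refine ⟨k, fun x => ?_⟩
  obtain ⟨n, hn⟩ := hFG (Int.fract x)
  have hF0 := F.monotone (Int.fract_nonneg x)
  have hG0 := G.monotone (Int.fract_nonneg x)
  have hF1 := hF.1 (Int.fract_lt_one x)
  have hG1 := hG.1 (Int.fract_lt_one x)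
  have hF2 := F.map_add_one 0
  have hG2 := G.map_add_one 0
  rw [zero_add] at hF2 hG2
  have h1 : (n : ℝ) < k + 1 := by linarith
  have h2 : (k : ℝ) < n + 1 := by linarith
  have h3 : n = k := by
    norm_cast at h1 h2
    omega
  subst h3
  linarith [F.map_fract_sub_fract_eq x, G.map_fract_sub_fract_eq x]

lemma CircleDeg1Lift.translationNumber_eq_add_int {F G : CircleDeg1Lift} {k : ℤ}
    (h : ∀ x, F x = G x + k) : F.translationNumber = G.translationNumber + k := by
  have hF : F = (translate (Multiplicative.ofAdd (k : ℝ)) : CircleDeg1Lift) * G := by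
    ext x
    rw [mul_apply, translate_apply, h, add_comm]
  have hc : Commute (translate (Multiplicative.ofAdd (k : ℝ)) : CircleDeg1Lift) G := by
    refine CircleDeg1Lift.ext fun x => ?_
    rw [mul_apply, mul_apply, translate_apply, translate_apply, G.map_int_add]
  rw [hF, translationNumber_mul_of_commute hc, translationNumber_translate, add_comm]

lemma IsOPH.exists_posLift_eq {f : S1 → S1} (hf : IsOPH f) :
    ∃ F : CircleDeg1Lift, ⇑F = posLift f ∧ IsCircleLift f F := by
  have h : ∃ F, IsCircleLift f F ∧ F 0 ∈ Set.Ico (0 : ℝ) 1 := by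
    obtain ⟨F, h1, h2, h3, h4⟩ := hf
    refine ⟨fun x => F x - ⌊F 0⌋, ⟨fun x y hxy => ?_, fun y => ?_, fun x => ?_, fun x => ?_⟩,
      Int.fract_nonneg _, Int.fract_lt_one _⟩
    · exact sub_lt_sub_right (h1 hxy) _
    · obtain ⟨x, hx⟩ := h2 (y + ⌊F 0⌋)
      exact ⟨x, by simp [hx]⟩
    · simp only [h3]
      ring
    · rw [h4, S1.coe_eq_coe_iff]
      exact ⟨⌊F 0⌋, by ring⟩
  have hp : IsCircleLift f (posLift f) := by
    rw [posLift, dif_pos h]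
    exact h.choose_spec.1
  exact ⟨⟨⟨posLift f, hp.1.monotone⟩, hp.2.2.1⟩, rfl, hp⟩

/-- The rotation number is the class of the translation number of any lift. -/
lemma rotN_eq_translationNumber {f : S1 → S1} {F : CircleDeg1Lift} (hF : IsCircleLift f F) :
    rotN f = (F.translationNumber : S1) := by
  obtain ⟨G, hGf, hG⟩ := IsOPH.exists_posLift_eq ⟨F, hF⟩
  have hlim : rotN f = (G.translationNumber : S1) := by
    have := G.tendsto_translation_number₀
    simp only [CircleDeg1Lift.coe_pow, hGf] at this
    rw [rotN, this.limUnder_eq]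
  obtain ⟨k, hk⟩ := hG.exists_eq_add_int hF
  rw [hlim, S1.coe_eq_coe_iff]
  exact ⟨k, CircleDeg1Lift.translationNumber_eq_add_int hk⟩

/-- For an action of an amenable group, the translation number is additive on lifts. -/
lemma translationNumber_mul_of_amenable {Γ : Type*} [Group Γ] (hΓ : HasInvariantMean Γ)
    {ρ : Γ → S1 → S1} (hρ : IsCircleAction Γ ρ) {γ δ : Γ} {F G : CircleDeg1Lift}
    (hF : IsCircleLift (ρ γ) F) (hG : IsCircleLift (ρ δ) G) :
    (F * G).translationNumber = F.translationNumber + G.translationNumber := by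
  obtain ⟨m, hadd, hsmul, hpos, hone, hinv⟩ := hΓ
  obtain ⟨-, hρ1, hρmul⟩ := hρ
  choose y hy using fun η => QuotientAddGroup.mk_surjective (ρ η 0)
  -- the mean displacement of a lift along the orbit of `0`
  let T (F : CircleDeg1Lift) : ℝ := m fun η => F (y η) - y η
  have hbdd (F : CircleDeg1Lift) : IsBdd fun η => F (y η) - y η :=
    .of_abs_sub_le fun η => F.abs_map_sub_sub_map_zero_le (y η)
  have hT0 (F : CircleDeg1Lift) : |T F - F 0| ≤ 1 :=
    abs_mean_sub_le hadd hsmul hpos hone fun η => F.abs_map_sub_sub_map_zero_le (y η)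
  have hTmul (F : CircleDeg1Lift) {δ : Γ} {G : CircleDeg1Lift} (hG : IsCircleLift (ρ δ) G) :
      T (F * G) = T F + T G := by
    have hfun : (fun η => (F * G) (y η) - y η) =
        (fun η => F (y (δ * η)) - y (δ * η)) + fun η => G (y η) - y η := by
      funext η
      have hcoe : ((G (y η) : ℝ) : S1) = (y (δ * η) : S1) := by
        rw [← hG.2.2.2]
        refine Eq.trans ?_ (hy (δ * η)).symm
        rw [hρmul]
        exact congrArg (ρ δ) (hy η)
      have := F.map_sub_eq_of_coe_eq hcoe
      simp only [Pi.add_apply, CircleDeg1Lift.mul_apply]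
      linarith
    have hshift : IsBdd fun η => F (y (δ * η)) - y (δ * η) :=
      (hbdd F).imp fun _ h η => h (δ * η)
    change m _ = m _ + m _
    rw [hfun, hadd _ _ hshift (hbdd G), hinv δ _ (hbdd F)]
  have hT {γ : Γ} {F : CircleDeg1Lift} (hF : IsCircleLift (ρ γ) F) :
      T F = F.translationNumber := by
    have hpow (n : ℕ) : T (F ^ (n + 1)) = (n + 1) * T F := by
      induction n with
      | zero => simp
      | succ n ih =>
        rw [pow_succ, hTmul _ hF, ih]
        push_cast
        ring
    refine tendsto_nhds_unique ?_ F.tendsto_translation_number₀'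
    have hzero : Tendsto (fun n : ℕ => 1 / ((n : ℝ) + 1)) atTop (nhds 0) :=
      tendsto_one_div_add_atTop_nhds_zero_nat
    refine tendsto_iff_dist_tendsto_zero.2 (squeeze_zero (fun _ => dist_nonneg) (fun n => ?_) hzero)
    have hn : (0 : ℝ) < n + 1 := by positivity
    have := hT0 (F ^ (n + 1))
    rw [hpow, abs_sub_comm] at this
    rw [Real.dist_eq, div_sub' hn.ne', abs_div, abs_of_pos hn]
    gcongr
  have hFG : IsCircleLift (ρ (γ * δ)) (F * G : CircleDeg1Lift) := by
    rw [hρmul, CircleDeg1Lift.coe_mul]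
    exact hF.comp hG
  rw [← hT hF, ← hT hG, ← hT hFG, hTmul F hG]

/-- If `Γ` is amenable then for every homomorphism `ρ : Γ → Homeo⁺(S¹)` the map
`γ ↦ rot(ρ(γ))` is a group homomorphism `Γ → ℝ/ℤ`. -/
theorem rotation_number_is_homomorphism_of_amenable
    {Γ : Type*} [Group Γ] (hΓ : HasInvariantMean Γ)
    (ρ : Γ → S1 → S1) (hρ : IsCircleAction Γ ρ) :
    ∀ γ η : Γ, rotN (ρ (γ * η)) = rotN (ρ γ) + rotN (ρ η) := by
  intro γ η
  obtain ⟨F, -, hF⟩ := (hρ.1 γ).exists_posLift_eq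
  obtain ⟨G, -, hG⟩ := (hρ.1 η).exists_posLift_eq
  have hFG : IsCircleLift (ρ (γ * η)) (F * G : CircleDeg1Lift) := by
    rw [hρ.2.2, CircleDeg1Lift.coe_mul]
    exact hF.comp hG
  rw [rotN_eq_translationNumber hF, rotN_eq_translationNumber hG, rotN_eq_translationNumber hFG,
    translationNumber_mul_of_amenable hΓ hρ hF hG, AddCircle.coe_add]

end
end

section
/- Let Γ be a group, let ρ, ρ₀ : Γ → Homeo⁺(S¹) be minimal strongly proximal actions, and let φ : S¹ → S¹ be a continuous non-constant map with φ∘ρ(γ) = ρ₀(γ)∘φ for all γ ∈ Γ. Then φ is a homeomorphism of S¹. -/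
open Filter MeasureTheory Set
open scoped Classical

noncomputable section

/-- Every orbit of the action is dense. -/
def MinimalAction {Γ : Type*} (ρ : Γ → S1 → S1) : Prop :=
  ∀ x : S1, Dense (Set.range fun γ => ρ γ x)

/-- Strong proximality: for every Borel probability measure `μ` on `S¹`, the weak-*
closure of the orbit of `μ` contains a Dirac mass. -/
def StronglyProximal {Γ : Type*} (ρ : Γ → S1 → S1) : Prop :=
  ∀ μ : ProbabilityMeasure S1, ∃ m : S1,
    (⟨Measure.dirac m, by infer_instance⟩ : ProbabilityMeasure S1) ∈
      closure {ν : ProbabilityMeasure S1 |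
        ∃ γ, (ν : Measure S1) = Measure.map (ρ γ) (μ : Measure S1)}

/-- An orientation preserving homeomorphism of the circle is continuous. -/
lemma IsOPH.continuous {f : S1 → S1} (hf : IsOPH f) : Continuous f := by
  obtain ⟨F, hmono, hsurj, -, hF⟩ := hf
  have hFc : Continuous F := hmono.monotone.continuous_of_surjective hsurj
  refine (QuotientAddGroup.isQuotientMap_mk _).continuous_iff.2 ?_
  have h : f ∘ (QuotientAddGroup.mk : ℝ → S1) = fun x : ℝ => ((F x : ℝ) : S1) := funext hF
  rw [h]
  exact (AddCircle.continuous_mk' 1).comp hFc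

lemma IsCircleAction.apply_inv_apply {Γ : Type*} [Group Γ] {ρ : Γ → S1 → S1}
    (hρ : IsCircleAction Γ ρ) (γ : Γ) (x : S1) : ρ γ (ρ γ⁻¹ x) = x := by
  have h := congrFun (hρ.2.2 γ γ⁻¹) x
  rw [mul_inv_cancel, hρ.2.1] at h
  exact h.symm

lemma IsCircleAction.injective {Γ : Type*} [Group Γ] {ρ : Γ → S1 → S1}
    (hρ : IsCircleAction Γ ρ) (γ : Γ) : Function.Injective (ρ γ) := by
  refine Function.LeftInverse.injective (g := ρ γ⁻¹) fun x => ?_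
  simpa using hρ.apply_inv_apply γ⁻¹ x

/-- A continuous equivariant map into a minimal action is surjective. -/
lemma MinimalAction.surjective_of_equivariant {Γ : Type*} {ρ ρ₀ : Γ → S1 → S1}
    (hmin₀ : MinimalAction ρ₀) {φ : S1 → S1} (hcont : Continuous φ)
    (hequiv : ∀ γ, φ ∘ ρ γ = ρ₀ γ ∘ φ) : Function.Surjective φ := by
  have hd : Dense (range φ) := (hmin₀ (φ 0)).mono <| by
    rintro _ ⟨γ, rfl⟩
    exact ⟨ρ γ 0, congrFun (hequiv γ) 0⟩
  exact range_eq_univ.1 ((isCompact_range hcont).isClosed.closure_eq ▸ hd.closure_eq)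

/-- Under a strongly proximal action, some translate of any probability measure gives arbitrarily
small mass to every closed set avoiding the limit point. -/
lemma StronglyProximal.exists_measure_preimage_lt {Γ : Type*} [Group Γ] {ρ : Γ → S1 → S1}
    (hρ : IsCircleAction Γ ρ) (hsp : StronglyProximal ρ) (μ : ProbabilityMeasure S1) :
    ∃ m : S1, ∀ A : Set S1, IsClosed A → m ∉ A → ∀ ε : ENNReal, 0 < ε →
      ∃ γ, (μ : Measure S1) (ρ γ ⁻¹' A) < ε := by
  obtain ⟨m, hm⟩ := hsp μ
  refine ⟨m, fun A hA hmA ε hε => ?_⟩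
  let D : ProbabilityMeasure S1 := ⟨Measure.dirac m, inferInstance⟩
  let S : Set (ProbabilityMeasure S1) := {ν |
    ∃ γ, (ν : Measure S1) = Measure.map (ρ γ) (μ : Measure S1)}
  have hD : (nhdsWithin D S).NeBot := mem_closure_iff_nhdsWithin_neBot.1 hm
  have hlim := ProbabilityMeasure.limsup_measure_closed_le_of_tendsto
    (tendsto_id.mono_left (nhdsWithin_le_nhds (a := D) (s := S))) hA
  have h0 : (D : Measure S1) A = 0 := by
    change Measure.dirac m A = 0
    simp [Measure.dirac_apply' m hA.measurableSet, hmA]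
  rw [h0] at hlim
  obtain ⟨ν, hν, γ, hγ⟩ :=
    ((eventually_lt_of_limsup_lt (hlim.trans_lt hε)).and eventually_mem_nhdsWithin).exists
  refine ⟨γ, ?_⟩
  rw [← Measure.map_apply (hρ.1 γ).continuous.measurable hA.measurableSet, ← hγ]
  exact hν

/-- The image in the circle of an interval of length at most one has measure at least the length
of the interval. -/
lemma ofReal_sub_le_volume_image_Icc {a b : ℝ} (hab : b ≤ a + 1) :
    ENNReal.ofReal (b - a) ≤ volume (((↑) : ℝ → S1) '' Icc a b) := by
  have hmeas : MeasurableSet (((↑) : ℝ → S1) '' Icc a b) :=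
    (isCompact_Icc.image (AddCircle.continuous_mk' 1)).isClosed.measurableSet
  rw [← (AddCircle.measurePreserving_mk 1 a).measure_preimage hmeas.nullMeasurableSet,
    ← Real.volume_Ioc]
  refine (le_of_eq ?_).trans (measure_mono (subset_preimage_image _ _))
  rw [Measure.restrict_apply measurableSet_Icc]
  congr 1
  ext x
  simp only [mem_inter_iff, mem_Icc, mem_Ioc]
  grind

/-- An orientation preserving homeomorphism pulls back an arc to an arc. -/
lemma IsOPH.exists_preimage_image_Icc {f : S1 → S1} (hf : IsOPH f) (hinj : Function.Injective f)
    {c d : ℝ} (hcd : d ≤ c + 1) :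
    ∃ a b : ℝ, b ≤ a + 1 ∧
      f ⁻¹' (((↑) : ℝ → S1) '' Icc c d) = ((↑) : ℝ → S1) '' Icc a b := by
  obtain ⟨F, hmono, hsurj, hone, hF⟩ := hf
  obtain ⟨a, rfl⟩ := hsurj c
  obtain ⟨b, rfl⟩ := hsurj d
  refine ⟨a, b, hmono.le_iff_le.1 (by rwa [hone]), Subset.antisymm ?_ ?_⟩
  · rintro x ⟨s, hs, hsx⟩
    obtain ⟨t, rfl⟩ := hsurj s
    refine ⟨t, ⟨hmono.le_iff_le.1 hs.1, hmono.le_iff_le.1 hs.2⟩, hinj ?_⟩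
    rw [hF, hsx]
  · rintro _ ⟨t, ht, rfl⟩
    exact ⟨F t, ⟨hmono.monotone ht.1, hmono.monotone ht.2⟩, (hF t).symm⟩

/-- The complement of any nonempty open set can be moved off any arc avoiding a fixed point. -/
lemma StronglyProximal.exists_contraction {Γ : Type*} [Group Γ] {ρ : Γ → S1 → S1}
    (hρ : IsCircleAction Γ ρ) (hmin : MinimalAction ρ) (hsp : StronglyProximal ρ) :
    ∃ m : S1, ∀ c d : ℝ, d ≤ c + 1 → m ∉ ((↑) : ℝ → S1) '' Icc c d →
      ∀ U : Set S1, IsOpen U → U.Nonempty →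
        ∃ γ, ∀ x ∉ U, ρ γ x ∉ ((↑) : ℝ → S1) '' Icc c d := by
  obtain ⟨m, hm⟩ := hsp.exists_measure_preimage_lt hρ
    ⟨volume, ⟨by simp [AddCircle.measure_univ]⟩⟩
  refine ⟨m, fun c d hcd hmA U hU hUne => ?_⟩
  obtain ⟨δ, hδ, hball⟩ := lebesgue_number_lemma_of_metric (s := univ) (c := fun g => ρ g ⁻¹' U)
    isCompact_univ (fun g => hU.preimage (hρ.1 g).continuous) fun x _ => by
      obtain ⟨_, hy, g, rfl⟩ := (hmin x).inter_open_nonempty U hU hUne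
      exact mem_iUnion.2 ⟨g, hy⟩
  obtain ⟨γ, hγ⟩ : ∃ γ, volume (ρ γ ⁻¹' (((↑) : ℝ → S1) '' Icc c d)) < ENNReal.ofReal δ :=
    hm _ (isCompact_Icc.image (AddCircle.continuous_mk' 1)).isClosed hmA _ (ENNReal.ofReal_pos.2 hδ)
  obtain ⟨a, b, hab, hpre⟩ := (hρ.1 γ).exists_preimage_image_Icc (hρ.injective γ) hcd
  rw [hpre] at hγ
  have hlt : b - a < δ :=
    (ENNReal.ofReal_lt_ofReal_iff hδ).1 ((ofReal_sub_le_volume_image_Icc hab).trans_lt hγ)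
  obtain ⟨g, hg⟩ := hball (a : S1) (mem_univ _)
  refine ⟨γ * g⁻¹, fun x hx hxA => hx ?_⟩
  rw [hρ.2.2] at hxA
  have hmem : ρ g⁻¹ x ∈ ρ γ ⁻¹' (((↑) : ℝ → S1) '' Icc c d) := hxA
  rw [hpre] at hmem
  obtain ⟨t, ht, htx⟩ := hmem
  have hU' : ρ g⁻¹ x ∈ ρ g ⁻¹' U := hg <| by
    rw [← htx, Metric.mem_ball, dist_eq_norm, ← AddCircle.coe_sub]
    refine (QuotientAddGroup.norm_mk_le_norm).trans_lt ?_
    rw [Real.norm_eq_abs, abs_of_nonneg (by linarith [ht.1])]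
    linarith [ht.2]
  rwa [mem_preimage, hρ.apply_inv_apply] at hU'

/-- A continuous factor map of a minimal strongly proximal action is irreducible: no proper closed
subset surjects onto the circle. -/
lemma StronglyProximal.image_compl_ne_univ {Γ : Type*} [Group Γ] {ρ ρ₀ : Γ → S1 → S1}
    (hρ : IsCircleAction Γ ρ) (hρ₀ : IsCircleAction Γ ρ₀) (hmin : MinimalAction ρ)
    (hsp : StronglyProximal ρ) {φ : S1 → S1} (hcont : Continuous φ)
    (hequiv : ∀ γ, φ ∘ ρ γ = ρ₀ γ ∘ φ) {U : Set S1} (hU : IsOpen U) (hUne : U.Nonempty) :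
    φ '' Uᶜ ≠ univ := by
  obtain ⟨m, hm⟩ := hsp.exists_contraction hρ hmin
  obtain ⟨m, rfl⟩ := QuotientAddGroup.mk_surjective m
  have : Nontrivial S1 := ⟨((0 : ℝ) : S1), ((1 / 2 : ℝ) : S1), fun h => by
    have := (AddCircle.coe_eq_coe_iff_of_mem_Ico (p := (1 : ℝ)) (a := 0)
      (by norm_num) (by norm_num)).1 h
    norm_num at this⟩
  obtain ⟨q, hq⟩ := exists_ne (φ (m : S1))
  have hnhds : ∀ᶠ t : ℝ in nhds m, φ (t : S1) ≠ q :=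
    (hcont.comp (AddCircle.continuous_mk' 1)).continuousAt.eventually_ne hq.symm
  obtain ⟨r, hr, hball⟩ := Metric.eventually_nhds_iff.1 hnhds
  obtain ⟨γ, hγ⟩ := hm (m + r / 2) (m + 1 - r / 2) (by linarith) (by
    rintro ⟨t, ht, htm⟩
    have : t = m := (AddCircle.coe_eq_coe_iff_of_mem_Ico (p := (1 : ℝ)) (a := m)
      ⟨by linarith [ht.1], by linarith [ht.2]⟩ ⟨le_rfl, by linarith⟩).1 htm
    linarith [ht.1]) U hU hUne
  intro huniv
  obtain ⟨x, hx, hxq⟩ := huniv.ge (mem_univ (ρ₀ γ⁻¹ q))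
  have hφq : φ (ρ γ x) = q := by
    rw [← hρ₀.apply_inv_apply γ q, ← hxq]
    exact congrFun (hequiv γ) x
  obtain ⟨t, ht, htx⟩ : ρ γ x ∈ ((↑) : ℝ → S1) '' Ico (m - r / 2) (m - r / 2 + 1) := by
    rw [AddCircle.coe_image_Ico_eq]
    exact mem_univ _
  rcases lt_or_ge t (m + r / 2) with hlt | hge
  · refine hball (y := t) ?_ (by rw [htx, hφq])
    rw [Real.dist_eq, abs_lt]
    constructor <;> linarith [ht.1]
  · exact hγ x hx ⟨t, ⟨hge, by linarith [ht.2]⟩, htx⟩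

/-- A continuous function taking equal values at the endpoints of an interval takes all its values
already off some nonempty open subset. -/
lemma exists_isOpen_image_subset_image_diff {f : ℝ → ℝ} {a b : ℝ} (hab : a < b)
    (hf : ContinuousOn f (Icc a b)) (hfab : f a = f b) :
    ∃ U ⊆ Ioo a b, IsOpen U ∧ U.Nonempty ∧ f '' U ⊆ f '' (Icc a b \ U) := by
  by_cases hconst : ∀ s ∈ Icc a b, f s = f a
  · refine ⟨Ioo a b, Subset.rfl, isOpen_Ioo, nonempty_Ioo.2 hab, ?_⟩
    rintro _ ⟨t, ht, rfl⟩
    exact ⟨a, ⟨left_mem_Icc.2 hab.le, by simp⟩, (hconst t (Ioo_subset_Icc_self ht)).symm⟩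
  push Not at hconst
  obtain ⟨s, hs, hsa⟩ := hconst
  have hf₁ : ContinuousOn f (Icc a s) := hf.mono (Icc_subset_Icc_right hs.2)
  have hf₂ : ContinuousOn f (Icc s b) := hf.mono (Icc_subset_Icc_left hs.1)
  obtain ⟨V, hV, hVne, h₁, h₂⟩ : ∃ V : Set ℝ, IsOpen V ∧ V.Nonempty ∧
      V ⊆ f '' Ioo a s ∧ V ⊆ f '' Ioo s b := by
    rcases lt_or_gt_of_ne hsa with h | h
    · exact ⟨Ioo (f s) (f a), isOpen_Ioo, nonempty_Ioo.2 h, intermediate_value_Ioo' hs.1 hf₁,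
        hfab ▸ intermediate_value_Ioo hs.2 hf₂⟩
    · exact ⟨Ioo (f a) (f s), isOpen_Ioo, nonempty_Ioo.2 h, intermediate_value_Ioo hs.1 hf₁,
        hfab ▸ intermediate_value_Ioo' hs.2 hf₂⟩
  refine ⟨Ioo a s ∩ f ⁻¹' V, fun t ht => ⟨ht.1.1, ht.1.2.trans_le hs.2⟩,
    (hf₁.mono Ioo_subset_Icc_self).isOpen_inter_preimage isOpen_Ioo hV, ?_, ?_⟩
  · obtain ⟨v, hv⟩ := hVne
    obtain ⟨t, ht, rfl⟩ := h₁ hv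
    exact ⟨t, ht, hv⟩
  · rintro _ ⟨t, ht, rfl⟩
    obtain ⟨u, hu, hut⟩ := h₂ ht.2
    exact ⟨u, ⟨⟨hs.1.trans hu.1.le, hu.2.le⟩, fun h => lt_asymm hu.1 h.1.2⟩, hut⟩

/-- A continuous irreducible surjection of the circle is injective. -/
lemma injective_of_image_compl_ne_univ {φ : S1 → S1} (hcont : Continuous φ)
    (hsurj : Function.Surjective φ)
    (hirr : ∀ U : Set S1, IsOpen U → U.Nonempty → φ '' Uᶜ ≠ univ) : Function.Injective φ := by
  intro x y hxy
  by_contra hne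
  obtain ⟨a, rfl⟩ := QuotientAddGroup.mk_surjective x
  obtain ⟨b, hb, rfl⟩ : y ∈ ((↑) : ℝ → S1) '' Ico a (a + 1) := by
    rw [AddCircle.coe_image_Ico_eq]
    exact mem_univ _
  have hab : a < b := lt_of_le_of_ne hb.1 fun h => hne (by rw [h])
  have hinj : ∀ s ∈ Ico a (a + 1), ∀ t ∈ Ico a (a + 1), (s : S1) = t → s = t :=
    fun s hs t ht h => (AddCircle.coe_eq_coe_iff_of_mem_Ico (p := (1 : ℝ)) hs ht).1 h
  have hsub : Icc a b ⊆ Ico a (a + 1) := fun t ht => ⟨ht.1, ht.2.trans_lt hb.2⟩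
  have hA : IsClosed (((↑) : ℝ → S1) '' Icc a b) :=
    (isCompact_Icc.image (AddCircle.continuous_mk' 1)).isClosed
  have hAimg := hirr _ hA.isOpen_compl (by
    obtain ⟨z, hbz, hz⟩ := exists_between hb.2
    refine ⟨(z : S1), ?_⟩
    rintro ⟨t, ht, htz⟩
    have := hinj t (hsub ht) z ⟨hab.le.trans hbz.le, hz⟩ htz
    linarith [ht.2])
  rw [compl_compl, Ne, eq_univ_iff_forall, not_forall] at hAimg
  obtain ⟨q, hq⟩ := hAimg
  obtain ⟨q, rfl⟩ := QuotientAddGroup.mk_surjective q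
  let f : ℝ → ℝ := fun t => AddCircle.equivIco 1 q (φ (t : S1))
  have hfφ : ∀ t, ((f t : ℝ) : S1) = φ (t : S1) := fun t =>
    (AddCircle.equivIco 1 q).symm_apply_apply (φ (t : S1))
  have hf : ContinuousOn f (Icc a b) := fun t ht => by
    have hqt : φ (t : S1) ≠ (q : S1) := fun h => hq ⟨t, ⟨t, ht, rfl⟩, h⟩
    have h₁ : ContinuousAt (fun t : ℝ => φ (t : S1)) t :=
      (hcont.comp (AddCircle.continuous_mk' 1)).continuousAt
    have h₂ := (AddCircle.continuousAt_equivIco 1 q hqt).comp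
      (f := fun t : ℝ => φ (t : S1)) (x := t) h₁
    exact (continuous_subtype_val.continuousAt.comp h₂).continuousWithinAt
  obtain ⟨U, hUab, hU, hUne, hUimg⟩ :=
    exists_isOpen_image_subset_image_diff hab hf
      (congrArg (fun z => (AddCircle.equivIco 1 q z : ℝ)) hxy)
  refine hirr (((↑) : ℝ → S1) '' U) (QuotientAddGroup.isOpenMap_coe U hU) (hUne.image _)
    (eq_univ_of_forall fun p => ?_)
  obtain ⟨z, rfl⟩ := hsurj p
  by_cases hz : z ∈ ((↑) : ℝ → S1) '' U
  · obtain ⟨u, hu, rfl⟩ := hz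
    obtain ⟨v, hv, hvu⟩ := hUimg ⟨u, hu, rfl⟩
    refine ⟨(v : S1), ?_, by rw [← hfφ, ← hfφ, hvu]⟩
    rintro ⟨w, hw, hwv⟩
    rw [hinj w (hsub (Ioo_subset_Icc_self (hUab hw))) v (hsub hv.1) hwv] at hw
    exact hv.2 hw
  · exact ⟨z, hz, rfl⟩

/-- If `ρ, ρ₀ : Γ → Homeo⁺(S¹)` are minimal strongly proximal actions and
`φ : S¹ → S¹` is a continuous non-constant map with `φ ∘ ρ(γ) = ρ₀(γ) ∘ φ` for all
`γ`, then `φ` is a homeomorphism. -/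
theorem factor_map_between_minimal_strongly_proximal_is_homeomorph
    {Γ : Type*} [Group Γ] (ρ ρ₀ : Γ → S1 → S1)
    (hρ : IsCircleAction Γ ρ) (hρ₀ : IsCircleAction Γ ρ₀)
    (hmin : MinimalAction ρ) (hsp : StronglyProximal ρ)
    (hmin₀ : MinimalAction ρ₀) (hsp₀ : StronglyProximal ρ₀)
    (φ : S1 → S1) (hcont : Continuous φ) (hnc : ¬ ∃ c : S1, φ = fun _ => c)
    (hequiv : ∀ γ : Γ, φ ∘ ρ γ = ρ₀ γ ∘ φ) :
    IsHomeomorph φ := by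
  have hsurj := hmin₀.surjective_of_equivariant hcont hequiv
  exact isHomeomorph_iff_continuous_bijective.2 ⟨hcont, injective_of_image_compl_ne_univ hcont hsurj
    fun _ hU hUne => hsp.image_compl_ne_univ hρ hρ₀ hmin hcont hequiv hU hUne, hsurj⟩

end
end
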